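/- arXiv:2303.12005 — 7 statements merged into one kernel-verified Lean document; each statement's English description precedes it below -/
import Mathlib

section
/- Let a be a positive integer and b_1, …, b_8 nonnegative integers such that a ≥ b_i for every i and 2a ≥ b_1 + … + b_8. Then the vector c = a·h − Σ_{i=1}^8 b_i·e_i is a nonnegative integer linear combination of the vectors e_1, …, e_8 and the vectors ℓ_{ij} = h − e_i − e_j for 1 ≤ i < j ≤ 8. -/
noncomputable section

/-- `N = ℝ^9`, the space of `1`-cycles on the blowup of `ℙ³` at eight points. -/
abbrev N : Type := Fin 9 → ℝ

/-- The class `h` of a general line. -/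
def hv : N := fun j => if j = 0 then 1 else 0

/-- The classes `e_1, …, e_8` of lines in the exceptional divisors (indexed by `Fin 8`). -/
def ev (i : Fin 8) : N := fun j => if j = i.succ then 1 else 0

/-- The class `ℓ_{ij} = h − e_i − e_j` of the line through the points `p_i` and `p_j`. -/
def lv (i j : Fin 8) : N := hv - ev i - ev j

/-- The additive monoid of nonnegative integer combinations of the `ev i` and the `lv i j`. -/
def linesMonoid : AddSubmonoid N where
  carrier := {v | ∃ (ce : Fin 8 → ℕ) (cl : Fin 8 → Fin 8 → ℕ),
    v = (∑ i : Fin 8, (ce i : ℝ) • ev i) +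
      ∑ i : Fin 8, ∑ j : Fin 8, (if i < j then (cl i j : ℝ) • lv i j else 0)}
  zero_mem' := ⟨0, 0, by simp⟩
  add_mem' := by
    rintro _ _ ⟨ce, cl, rfl⟩ ⟨ce', cl', rfl⟩
    refine ⟨ce + ce', cl + cl', ?_⟩
    have key : ∀ i j : Fin 8,
        (if i < j then (((cl + cl') i j : ℕ) : ℝ) • lv i j else 0) =
          (if i < j then (cl i j : ℝ) • lv i j else 0) +
            (if i < j then (cl' i j : ℝ) • lv i j else 0) := by
      intro i j
      split_ifs <;> simp [add_smul]
    simp only [key, Finset.sum_add_distrib]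
    simp only [Finset.sum_add_distrib, Pi.add_apply, Nat.cast_add, add_smul]
    abel

theorem ev_mem_linesMonoid (k : Fin 8) : ev k ∈ linesMonoid :=
  ⟨Pi.single k 1, 0, by simp [Pi.single_apply, ite_smul]⟩

theorem lv_comm (i j : Fin 8) : lv i j = lv j i := by
  unfold lv
  abel

theorem lv_mem_linesMonoid {i j : Fin 8} (hij : i ≠ j) : lv i j ∈ linesMonoid := by
  wlog h : i < j generalizing i j
  · rw [lv_comm]
    exact this hij.symm (lt_of_le_of_ne (not_lt.mp h) hij.symm)
  refine ⟨0, fun k l => if k = i then (if l = j then 1 else 0) else 0, ?_⟩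
  simp only [Pi.zero_apply, Nat.cast_zero, zero_smul, Finset.sum_const_zero, zero_add]
  rw [Finset.sum_eq_single i (fun k _ hk => by simp [hk]) (by simp),
    Finset.sum_eq_single j (fun l _ hl => by simp [hl]) (by simp)]
  simp [h]

/-- Lowering the multiplicities `b i` adds nonnegative multiples of the `ev i`. -/
theorem sub_sum_mem_linesMonoid_of_le {v : N} {b b' : Fin 8 → ℕ} (hle : b ≤ b')
    (h : v - ∑ i, (b' i : ℝ) • ev i ∈ linesMonoid) :
    v - ∑ i, (b i : ℝ) • ev i ∈ linesMonoid := by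
  obtain ⟨t, rfl⟩ := exists_add_of_le hle
  have ht : ∑ i, (t i : ℝ) • ev i ∈ linesMonoid := sum_mem fun i _ => by
    rw [Nat.cast_smul_eq_nsmul]
    exact nsmul_mem (ev_mem_linesMonoid i) _
  convert add_mem h ht using 1
  simp only [Pi.add_apply, Nat.cast_add, add_smul, Finset.sum_add_distrib]
  abel

/-- The two largest entries of a family indexed by `Fin 8`. -/
theorem exists_two_largest (b : Fin 8 → ℕ) :
    ∃ i j, i ≠ j ∧ b j ≤ b i ∧ ∀ k, k ≠ i → b k ≤ b j := by
  obtain ⟨i, -, hi⟩ := Finset.exists_max_image Finset.univ b Finset.univ_nonempty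
  have hne : (Finset.univ.erase i).Nonempty := by
    rw [← Finset.card_pos, Finset.card_erase_of_mem (Finset.mem_univ i)]
    simp
  obtain ⟨j, hj, hj'⟩ := Finset.exists_max_image (Finset.univ.erase i) b hne
  exact ⟨i, j, (Finset.ne_of_mem_erase hj).symm, hi j (Finset.mem_univ j),
    fun k hk => hj' k (Finset.mem_erase.mpr ⟨hk, Finset.mem_univ k⟩)⟩

theorem smul_hv_sub_mem_linesMonoid (a : ℕ) (b : Fin 8 → ℕ) (hb : ∀ i, b i ≤ a)
    (hsum : ∑ i, b i ≤ 2 * a) :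
    (a : ℝ) • hv - ∑ i, (b i : ℝ) • ev i ∈ linesMonoid := by
  induction a generalizing b with
  | zero =>
    have h0 : ∀ i, b i = 0 := fun i => Nat.le_zero.mp (hb i)
    simp [h0]
  | succ a ih =>
    obtain ⟨i, j, hij, hji, hmax⟩ := exists_two_largest b
    set b' : Fin 8 → ℕ := fun k => b k - (Pi.single i 1 + Pi.single j 1 : Fin 8 → ℕ) k with hb'
    have hi : b' i = b i - 1 := by simp [hb', hij]
    have hj : b' j = b j - 1 := by simp [hb', hij.symm]
    have hk : ∀ k, k ≠ i → k ≠ j → b' k = b k := fun k h1 h2 => by simp [hb', h1, h2]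
    have hle : b ≤ b' + (Pi.single i 1 + Pi.single j 1) := fun k => le_tsub_add
    have hb'a : ∀ k, b' k ≤ a := by
      intro k
      have hka := hb k
      by_cases h1 : k = i
      · subst h1; omega
      by_cases h2 : k = j
      · subst h2; omega
      have hthree : ∑ l ∈ {i, j, k}, b l ≤ ∑ l, b l :=
        Finset.sum_le_sum_of_subset (Finset.subset_univ _)
      rw [Finset.sum_insert (by simp [hij, Ne.symm h1]), Finset.sum_pair (Ne.symm h2)] at hthree
      have := hmax k h1
      rw [hk k h1 h2]
      omega
    have hb'sum : ∑ k, b' k ≤ 2 * a := by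
      rcases Nat.eq_zero_or_pos (b j) with h0 | hpos
      · rw [Finset.sum_eq_single i]
        · have := hb'a i
          omega
        · intro k _ hki
          have h1 := hmax k hki
          have h2 : b' k ≤ b k := Nat.sub_le _ _
          omega
        · simp
      · have heq : b = b' + (Pi.single i 1 + Pi.single j 1) := by
          funext k
          by_cases h1 : k = i
          · subst h1; simp [hi, hij]; omega
          by_cases h2 : k = j
          · subst h2; simp [hj, h1]; omega
          simp [hk k h1 h2, h1, h2]
        have hs : ∑ k, b k = ∑ k, b' k + (1 + 1) := by
          conv_lhs => rw [heq]
          simp only [Pi.add_apply, Finset.sum_add_distrib, Finset.sum_pi_single',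
            Finset.mem_univ, if_true]
        omega
    refine sub_sum_mem_linesMonoid_of_le hle ?_
    convert add_mem (ih b' hb'a hb'sum) (lv_mem_linesMonoid hij) using 1
    simp only [Pi.add_apply, Nat.cast_add, add_smul, Finset.sum_add_distrib, lv, Nat.cast_one,
      one_smul, Pi.single_apply, Nat.cast_ite, Nat.cast_zero, ite_smul, zero_smul,
      Finset.sum_ite_eq', Finset.mem_univ, if_true]
    abel

/-- **Lemma 5.1.** If `a` is a positive integer and `b_1, …, b_8` are nonnegative
integers with `a ≥ b_i` for all `i` and `2a ≥ b_1 + … + b_8`, then the class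
`c = a·h − ∑ b_i·e_i` is a nonnegative integer linear combination of the classes
`e_i` (`1 ≤ i ≤ 8`) and `ℓ_{ij} = h − e_i − e_j` (`1 ≤ i < j ≤ 8`). -/
theorem lines_combination (a : ℕ) (b : Fin 8 → ℕ) (ha : 0 < a)
    (hb : ∀ i, b i ≤ a) (hsum : ∑ i, b i ≤ 2 * a) :
    ∃ (ce : Fin 8 → ℕ) (cl : Fin 8 → Fin 8 → ℕ),
      (a : ℝ) • hv - ∑ i : Fin 8, (b i : ℝ) • ev i =
        (∑ i : Fin 8, (ce i : ℝ) • ev i) +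
        ∑ i : Fin 8, ∑ j : Fin 8,
          (if i < j then (cl i j : ℝ) • lv i j else 0) :=
    smul_hv_sub_mem_linesMonoid a b hb hsum
end
end

section
/- A vector D = dH − Σ_{i=1}^8 m_i E_i ∈ V with real coefficients satisfies m_i ≥ 0 for all i and d ≥ m_i + m_j for all i ≠ j if and only if D lies in the convex cone generated by H, the vectors H − E_i for 1 ≤ i ≤ 8, and the vectors 2H − Σ_{j∈J} E_j for every subset J ⊆ {1,…,8} with 3 ≤ |J| ≤ 8. In other words, these two convex cones in V coincide. -/
noncomputable section

abbrev V : Type := Fin 9 → ℝ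

/-- The hyperplane class `H`. -/
def Hv : V := fun j => if j = 0 then 1 else 0

/-- The exceptional classes `E_1, …, E_8` (indexed by `Fin 8`). -/
def Ev (i : Fin 8) : V := fun j => if j = i.succ then 1 else 0

/-- The class `(d; m_1, …, m_8) = d·H − ∑ m_i·E_i`. -/
def cls (d : ℝ) (m : Fin 8 → ℝ) : V := d • Hv - ∑ i : Fin 8, m i • Ev i

/-- The symmetric bilinear form with `(H,H) = 2`, `(E_i,E_j) = −δ_{ij}`, `(H,E_i) = 0`. -/
def form (x y : V) : ℝ := 2 * x 0 * y 0 - ∑ i : Fin 8, x i.succ * y i.succ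

/-- The canonical class `K = −4H + 2∑ E_i`. -/
def Kv : V := (-4 : ℝ) • Hv + (2 : ℝ) • ∑ i : Fin 8, Ev i

/-- The simple roots `α_0, …, α_7`:  `α_0 = H − E_1 − E_2 − E_3 − E_4` and
`α_i = E_i − E_{i+1}` for `i = 1, …, 7`. -/
def α (i : Fin 8) : V :=
  if i = 0 then Hv - Ev 0 - Ev 1 - Ev 2 - Ev 3 else Ev (i - 1) - Ev i

lemma form_add_right (a x y : V) : form a (x + y) = form a x + form a y := by
  simp only [form, Pi.add_apply, mul_add, Finset.sum_add_distrib]; ring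

lemma form_smul_right (a : V) (c : ℝ) (x : V) : form a (c • x) = c * form a x := by
  unfold form
  simp only [Pi.smul_apply, smul_eq_mul]
  rw [show ∑ i : Fin 8, a i.succ * (c * x i.succ)
      = c * ∑ i : Fin 8, a i.succ * x i.succ from by
    rw [Finset.mul_sum]; exact Finset.sum_congr rfl fun i _ => by ring]
  ring

/-- The reflection `x ↦ x + (a, x)·a` as a linear map. -/
def reflLin (a : V) : V →ₗ[ℝ] V where
  toFun x := x + form a x • a
  map_add' x y := by simp only [form_add_right, add_smul]; abel
  map_smul' c x := by
    simp only [form_smul_right, RingHom.id_apply, smul_add, smul_smul]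

lemma form_alpha_self (i : Fin 8) : form (α i) (α i) = -2 := by
  fin_cases i <;>
    simp +decide [form, α, Hv, Ev, Fin.sum_univ_eight] <;> norm_num

lemma refl_refl (a : V) (h : form a a = -2) (x : V) :
    reflLin a (reflLin a x) = x := by
  show (x + form a x • a) + form a (x + form a x • a) • a = x
  rw [form_add_right, form_smul_right, h]
  module

/-- The simple reflections `s_0, …, s_7` as linear automorphisms of `V`. -/
def sEquiv (i : Fin 8) : V ≃ₗ[ℝ] V :=
  LinearEquiv.ofLinear (reflLin (α i)) (reflLin (α i))
    (LinearMap.ext fun x => refl_refl _ (form_alpha_self i) x)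
    (LinearMap.ext fun x => refl_refl _ (form_alpha_self i) x)

/-- The Weyl group `W`, the subgroup of `GL(V)` generated by `s_0, …, s_7`. -/
def W : Subgroup (V ≃ₗ[ℝ] V) := Subgroup.closure (Set.range sEquiv)

/-- Membership in the convex cone generated by a set `S ⊆ V`. -/
def inCone (S : Set V) (x : V) : Prop :=
  ∃ (n : ℕ) (c : Fin n → ℝ) (g : Fin n → V),
    (∀ i, 0 ≤ c i) ∧ (∀ i, g i ∈ S) ∧ x = ∑ i, c i • g i

/-- The generators of the nef cone (Lemma `lem:nefcone`). -/
def nefGens : Set V :=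
  {Hv} ∪ (Set.range fun i : Fin 8 => Hv - Ev i) ∪
    {x | ∃ J : Finset (Fin 8), 3 ≤ J.card ∧ J.card ≤ 8 ∧
      x = (2 : ℝ) • Hv - ∑ j ∈ J, Ev j}

lemma cls_zero (d : ℝ) (m : Fin 8 → ℝ) : cls d m 0 = d := by
  simp [cls, Hv, Ev, (Fin.succ_ne_zero _).symm]

lemma cls_succ (d : ℝ) (m : Fin 8 → ℝ) (i : Fin 8) : cls d m i.succ = -m i := by
  simp [cls, Hv, Ev, Finset.sum_apply]

/-- A linear functional that is nonnegative on `S` is nonnegative on the cone generated by `S`. -/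
lemma inCone.nonneg_of_forall_mem {S : Set V} {x : V} (hx : inCone S x) (f : V →ₗ[ℝ] ℝ)
    (hf : ∀ y ∈ S, 0 ≤ f y) : 0 ≤ f x := by
  obtain ⟨n, c, g, hc, hg, rfl⟩ := hx
  rw [map_sum]
  refine Finset.sum_nonneg fun i _ => ?_
  rw [map_smul]
  exact mul_nonneg (hc i) (hf _ (hg i))

lemma two_smul_Hv_sub_sum_eq_cls (J : Finset (Fin 8)) :
    (2 : ℝ) • Hv - ∑ j ∈ J, Ev j = cls 2 (fun j => if j ∈ J then 1 else 0) := by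
  simp [cls, Finset.sum_ite_mem]

lemma Hv_eq_cls : Hv = cls 1 0 := by
  simp [cls]

lemma Hv_sub_Ev_eq_cls (i : Fin 8) : Hv - Ev i = cls 1 (Pi.single i 1) := by
  simp [cls, Pi.single_apply]

/-- Each generator satisfies the inequalities `0 ≤ m i` and `m i + m j ≤ d`. -/
lemma exists_eq_cls_of_mem_nefGens {x : V} (hx : x ∈ nefGens) :
    ∃ (d : ℝ) (m : Fin 8 → ℝ), x = cls d m ∧ (∀ i, 0 ≤ m i) ∧
      ∀ i j : Fin 8, i ≠ j → m i + m j ≤ d := by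
  rcases hx with (rfl | ⟨i, rfl⟩) | ⟨J, -, -, rfl⟩
  · exact ⟨1, 0, Hv_eq_cls, by simp, by simp⟩
  · refine ⟨1, Pi.single i 1, Hv_sub_Ev_eq_cls i, fun k => ?_, fun k l hkl => ?_⟩
    · rw [Pi.single_apply]; split_ifs <;> norm_num
    · rw [Pi.single_apply, Pi.single_apply]
      split_ifs with hk hl
      · exact absurd (hk.trans hl.symm) hkl
      all_goals norm_num
  · refine ⟨2, _, two_smul_Hv_sub_sum_eq_cls J, fun k => ?_, fun k l _ => ?_⟩
    · split_ifs <;> norm_num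
    · split_ifs <;> norm_num

lemma two_smul_Hv_sub_sum_Ici_mem_nefGens (σ : Equiv.Perm (Fin 8)) {k : Fin 8} (hk : k ≤ 5) :
    (2 : ℝ) • Hv - ∑ j ∈ Finset.Ici k, Ev (σ j) ∈ nefGens := by
  refine Or.inr ⟨(Finset.Ici k).map σ.toEmbedding, ?_, ?_, by simp⟩ <;>
    rw [Finset.card_map, Fin.card_Ici] <;> omega

/-- The inequalities are sufficient: order the multiplicities increasingly and peel off
the classes `2H − ∑_{j ≥ k} E_j`. -/
lemma inCone_nefGens_cls {d : ℝ} {m : Fin 8 → ℝ} (hm : ∀ i, 0 ≤ m i)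
    (hd : ∀ i j : Fin 8, i ≠ j → m i + m j ≤ d) : inCone nefGens (cls d m) := by
  set σ := Tuple.sort m
  have hmono {i j : Fin 8} (hij : i ≤ j) : m (σ i) ≤ m (σ j) := Tuple.monotone_sort m hij
  have hH : Hv ∈ nefGens := Or.inl (Or.inl rfl)
  have hE (i : Fin 8) : Hv - Ev i ∈ nefGens := Or.inl (Or.inr ⟨i, rfl⟩)
  let q (k : Fin 8) : V := (2 : ℝ) • Hv - ∑ j ∈ Finset.Ici k, Ev (σ j)
  have hq (k : Fin 8) (hk : k ≤ 5) : q k ∈ nefGens := two_smul_Hv_sub_sum_Ici_mem_nefGens σ hk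
  have hcls : cls d m = d • Hv - ∑ i, m (σ i) • Ev (σ i) := by
    rw [cls, Equiv.sum_comp σ fun i => m i • Ev i]
  refine ⟨9, ![m (σ 0), m (σ 1) - m (σ 0), m (σ 2) - m (σ 1), m (σ 3) - m (σ 2),
      m (σ 4) - m (σ 3), m (σ 5) - m (σ 4), m (σ 6) - m (σ 5), m (σ 7) - m (σ 5),
      d - (m (σ 6) + m (σ 7))],
    ![q 0, q 1, q 2, q 3, q 4, q 5, Hv - Ev (σ 6), Hv - Ev (σ 7), Hv], ?_, ?_, ?_⟩
  · have h67 : m (σ 6) + m (σ 7) ≤ d := hd _ _ (σ.injective.ne (by decide))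
    intro i
    fin_cases i
    · exact hm _
    all_goals first
      | exact sub_nonneg.2 h67
      | exact sub_nonneg.2 (hmono (by decide))
  · intro i
    fin_cases i
    all_goals first
      | exact hH
      | exact hE _
      | exact hq _ (by decide)
  · have hq_sum (k : Fin 8) :
        q k = (2 : ℝ) • Hv - ∑ j, if k ≤ j then Ev (σ j) else 0 := by
      rw [← Finset.sum_filter, Finset.filter_le_eq_Ici]
    rw [hcls, Fin.sum_univ_eight, Fin.sum_univ_succ, Fin.sum_univ_eight]
    simp +decide [hq_sum, Fin.sum_univ_eight]
    module

/-- **Lemma 5.2 (nef cone).** A class `D = dH − ∑ m_i E_i` satisfies `m_i ≥ 0` for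
all `i` and `d ≥ m_i + m_j` for all `i ≠ j` if and only if `D` lies in the convex
cone generated by `H`, the `H − E_i` (`1 ≤ i ≤ 8`), and the `2H − ∑_{j∈J} E_j`
for `J ⊆ {1,…,8}` with `3 ≤ |J| ≤ 8`. -/
theorem nef_cone_description (d : ℝ) (m : Fin 8 → ℝ) :
    ((∀ i, 0 ≤ m i) ∧ ∀ i j : Fin 8, i ≠ j → m i + m j ≤ d) ↔
      inCone nefGens (cls d m) := by
  refine ⟨fun h => inCone_nefGens_cls h.1 h.2, fun h => ⟨fun i => ?_, fun i j hij => ?_⟩⟩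
  · have := h.nonneg_of_forall_mem (-LinearMap.proj i.succ) fun y hy => by
      obtain ⟨e, n, rfl, hn, -⟩ := exists_eq_cls_of_mem_nefGens hy
      simpa [cls_succ] using hn i
    simpa [cls_succ] using this
  · let p (k : Fin 9) : V →ₗ[ℝ] ℝ := LinearMap.proj k
    have : 0 ≤ cls d m 0 + cls d m i.succ + cls d m j.succ := by
      refine h.nonneg_of_forall_mem (p 0 + p i.succ + p j.succ) fun y hy => ?_
      obtain ⟨e, n, rfl, -, hn⟩ := exists_eq_cls_of_mem_nefGens hy
      change 0 ≤ cls e n 0 + cls e n i.succ + cls e n j.succ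
      rw [cls_zero, cls_succ, cls_succ]
      linarith [hn i j hij]
    rw [cls_zero, cls_succ, cls_succ] at this
    linarith
end
end

section
/- Let D = (d; m_1, …, m_8) be an integer class in standard form such that d ≥ m_i ≥ 0 for all i ∈ {1, …, 8}. Then D lies in the cone Π. -/
noncomputable section

/-- The generators of the cone `Π` from Lemma `lem:standardinPi`. -/
def PiGens : Set V :=
  {Hv}
  ∪ {x | ∃ i : Fin 8, i.1 < 3 ∧ x = Hv - Ev i}
  ∪ {x | ∃ i j : Fin 8, i < j ∧ j.1 < 3 ∧ x = Hv - Ev i - Ev j}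
  ∪ {x | ∃ k : ℕ, 4 ≤ k ∧ k ≤ 8 ∧
      x = (2 : ℝ) • Hv - ∑ i ∈ Finset.univ.filter (fun i : Fin 8 => i.1 < k), Ev i}
  ∪ {x | ∃ l : ℕ, 4 ≤ l ∧ l ≤ 8 ∧
      x = (3 : ℝ) • Hv - (3 : ℝ) • Ev 0
          - ∑ i ∈ Finset.univ.filter (fun i : Fin 8 => 1 ≤ i.1 ∧ i.1 < l), Ev i}

/-- The cone `Π`, i.e. the convex cone generated by `PiGens`. -/
def PiCone : Set V := {x | inCone PiGens x}

/-- The closed fundamental chamber `C̄ = {x | (x, α_i) ≥ 0 for all i}`. -/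
def Cbar : Set V := {x | ∀ i : Fin 8, 0 ≤ form x (α i)}

/-- The set `B = {(d; m_1, …, m_8) | 0 ≤ m_i ≤ d for all i}`; here the `i`-th
multiplicity of `x` is `-x i.succ` and the degree is `x 0`. -/
def Bset : Set V := {x | ∀ i : Fin 8, 0 ≤ -x i.succ ∧ -x i.succ ≤ x 0}

/-- The orbit `W·E_8` of the exceptional class `E_8` under the Weyl group. -/
def orbitE8 : Set V := {x | ∃ w : V ≃ₗ[ℝ] V, w ∈ W ∧ x = w (Ev 7)}

lemma inCone_add {S : Set V} {x y : V} (hx : inCone S x) (hy : inCone S y) :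
    inCone S (x + y) := by
  obtain ⟨n, c, g, hc, hg, rfl⟩ := hx
  obtain ⟨n', c', g', hc', hg', rfl⟩ := hy
  refine ⟨n + n', Fin.append c c', Fin.append g g', fun i => ?_, fun i => ?_, ?_⟩
  · refine Fin.addCases (fun i => ?_) (fun i => ?_) i
    · simpa using hc i
    · simpa using hc' i
  · refine Fin.addCases (fun i => ?_) (fun i => ?_) i
    · simpa using hg i
    · simpa using hg' i
  · simp [Fin.sum_univ_add]

lemma inCone_smul {S : Set V} {x : V} (hx : x ∈ S) {c : ℝ} (hc : 0 ≤ c) : inCone S (c • x) :=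
  ⟨1, fun _ => c, fun _ => x, fun _ => hc, fun _ => hx, by simp⟩

lemma hyperplane_mem_PiGens : Hv ∈ PiGens := by simp [PiGens]

lemma hyperplane_sub_mem_PiGens {i : Fin 8} (hi : i.1 < 3) : Hv - Ev i ∈ PiGens :=
  Or.inl (Or.inl (Or.inl (Or.inr ⟨i, hi, rfl⟩)))

lemma hyperplane_sub_sub_mem_PiGens {i j : Fin 8} (hij : i < j) (hj : j.1 < 3) :
    Hv - Ev i - Ev j ∈ PiGens :=
  Or.inl (Or.inl (Or.inr ⟨i, j, hij, hj, rfl⟩))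

/-- The quadric class `2H - E_1 - ⋯ - E_k`. -/
def quadricClass (k : ℕ) : V :=
  (2 : ℝ) • Hv - ∑ i ∈ Finset.univ.filter (fun i : Fin 8 => i.1 < k), Ev i

/-- The cubic cone class `3H - 3E_1 - E_2 - ⋯ - E_l`. -/
def cubicClass (l : ℕ) : V :=
  (3 : ℝ) • Hv - (3 : ℝ) • Ev 0
    - ∑ i ∈ Finset.univ.filter (fun i : Fin 8 => 1 ≤ i.1 ∧ i.1 < l), Ev i

lemma quadricClass_mem_PiGens {k : ℕ} (h : 4 ≤ k) (h' : k ≤ 8) : quadricClass k ∈ PiGens :=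
  Or.inl (Or.inr ⟨k, h, h', rfl⟩)

lemma cubicClass_mem_PiGens {l : ℕ} (h : 4 ≤ l) (h' : l ≤ 8) : cubicClass l ∈ PiGens :=
  Or.inr ⟨l, h, h', rfl⟩

/-- A class supported on the first three points lies in `Π` as soon as its multiplicities are
bounded by the degree and add up to at most twice the degree. -/
lemma inCone_three_points {d a b c : ℝ} (ha : 0 ≤ a) (hb : 0 ≤ b) (hc : 0 ≤ c)
    (had : a ≤ d) (hbd : b ≤ d) (hcd : c ≤ d) (h : a + b + c ≤ 2 * d) :
    inCone PiGens (d • Hv - a • Ev 0 - b • Ev 1 - c • Ev 2) := by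
  obtain ⟨p, q, r, hp, hq, hr, hpq, hpr, hqr, hd⟩ : ∃ p q r : ℝ, 0 ≤ p ∧ 0 ≤ q ∧ 0 ≤ r ∧
      p + q ≤ a ∧ p + r ≤ b ∧ q + r ≤ c ∧ a + b + c - d ≤ p + q + r := by
    rcases le_total (a + b + c) d with h0 | h0
    · exact ⟨0, 0, 0, by simp, by simp, by simp, by simpa, by simpa, by simpa, by linarith⟩
    · rcases le_total (b + c) d with h1 | h1 <;> rcases le_total (a + c) d with h2 | h2
      · exact ⟨a + b + c - d, 0, 0, by linarith, le_rfl, le_rfl,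
          by linarith, by linarith, by linarith, by linarith⟩
      · exact ⟨b, a + c - d, 0, by linarith, by linarith, le_rfl,
          by linarith, by linarith, by linarith, by linarith⟩
      · exact ⟨a, 0, b + c - d, by linarith, le_rfl, by linarith,
          by linarith, by linarith, by linarith, by linarith⟩
      · exact ⟨d - c, a + c - d, b + c - d, by linarith, by linarith, by linarith,
          by linarith, by linarith, by linarith, by linarith⟩
  have key := inCone_add (inCone_add (inCone_add (inCone_add (inCone_add (inCone_add
    (inCone_smul (hyperplane_sub_sub_mem_PiGens (i := 0) (j := 1) (by decide) (by decide)) hp)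
    (inCone_smul (hyperplane_sub_sub_mem_PiGens (i := 0) (j := 2) (by decide) (by decide)) hq))
    (inCone_smul (hyperplane_sub_sub_mem_PiGens (i := 1) (j := 2) (by decide) (by decide)) hr))
    (inCone_smul (hyperplane_sub_mem_PiGens (i := 0) (by decide)) (sub_nonneg.2 hpq)))
    (inCone_smul (hyperplane_sub_mem_PiGens (i := 1) (by decide)) (sub_nonneg.2 hpr)))
    (inCone_smul (hyperplane_sub_mem_PiGens (i := 2) (by decide)) (sub_nonneg.2 hqr)))
    (inCone_smul hyperplane_mem_PiGens
      (show 0 ≤ d - a - b - c + (p + q + r) by linarith))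
  convert key using 1
  module

/-- A convex combination of a quadric class and a cubic class with the same points, scaled by
a nonnegative real, lies in `Π`. -/
lemma inCone_quadric_add_cubic {k : ℕ} (h : 4 ≤ k) (h' : k ≤ 8) {e t : ℝ} (he : 0 ≤ e)
    (ht : 0 ≤ t) (ht' : t ≤ 1) :
    inCone PiGens (((1 - t) * e) • quadricClass k + (t * e) • cubicClass k) :=
  inCone_add (inCone_smul (quadricClass_mem_PiGens h h') (mul_nonneg (sub_nonneg.2 ht') he))
    (inCone_smul (cubicClass_mem_PiGens h h') (mul_nonneg ht he))

/-- The real version of the standard form criterion: integrality plays no role. -/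
lemma inCone_of_standard_form {d : ℝ} {m : Fin 8 → ℝ} (hm : Antitone m)
    (hdeg : m 0 + m 1 + m 2 + m 3 ≤ 2 * d) (hd : m 0 ≤ d) (hnonneg : 0 ≤ m 7) :
    inCone PiGens (cls d m) := by
  have h01 : m 1 ≤ m 0 := hm (by decide)
  have h12 : m 2 ≤ m 1 := hm (by decide)
  have h23 : m 3 ≤ m 2 := hm (by decide)
  have h34 : m 4 ≤ m 3 := hm (by decide)
  have h45 : m 5 ≤ m 4 := hm (by decide)
  have h56 : m 6 ≤ m 5 := hm (by decide)
  have h67 : m 7 ≤ m 6 := hm (by decide)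
  obtain ⟨t, ht, ht', hlow, hmid, hhigh⟩ : ∃ t : ℝ, 0 ≤ t ∧ t ≤ 1 ∧
      m 0 + m 3 - d ≤ t * m 3 ∧ 2 * (t * m 3) ≤ m 0 - m 3 ∧ t * m 3 ≤ d - m 1 - m 3 := by
    rcases le_or_gt (m 0 + m 3) d with h | h
    · exact ⟨0, le_rfl, zero_le_one, by linarith, by linarith, by linarith⟩
    · have h3 : 0 < m 3 := by linarith
      refine ⟨(m 0 + m 3 - d) / m 3, div_nonneg (by linarith) h3.le,
        (div_le_one h3).2 (by linarith), ?_⟩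
      rw [div_mul_cancel₀ _ h3.ne']
      exact ⟨le_rfl, by linarith, by linarith⟩
  have key := inCone_add (inCone_add (inCone_add (inCone_add (inCone_add
    (inCone_three_points (d := d - 2 * m 3 - t * m 3) (a := m 0 - m 3 - 2 * (t * m 3))
      (b := m 1 - m 3) (c := m 2 - m 3) (by linarith) (by linarith) (by linarith)
      (by linarith) (by linarith) (by linarith) (by linarith))
    (inCone_quadric_add_cubic (k := 4) (by decide) (by decide) (sub_nonneg.2 h34) ht ht'))
    (inCone_quadric_add_cubic (k := 5) (by decide) (by decide) (sub_nonneg.2 h45) ht ht'))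
    (inCone_quadric_add_cubic (k := 6) (by decide) (by decide) (sub_nonneg.2 h56) ht ht'))
    (inCone_quadric_add_cubic (k := 7) (by decide) (by decide) (sub_nonneg.2 h67) ht ht'))
    (inCone_quadric_add_cubic (k := 8) (by decide) (by decide) hnonneg ht ht')
  convert key using 1
  simp [cls, quadricClass, cubicClass, Finset.sum_filter, Fin.sum_univ_eight]
  module

/-- **Lemma (standard form classes lie in `Π`).** Let `D = (d; m_1, …, m_8)` be an
integer class in standard form with `d ≥ m_i ≥ 0` for all `i`.  Then `D ∈ Π`. -/
theorem standard_form_in_Pi (d : ℤ) (m : Fin 8 → ℤ)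
    (hsorted : ∀ i j : Fin 8, i ≤ j → m j ≤ m i)
    (hdeg : m 0 + m 1 + m 2 + m 3 ≤ 2 * d)
    (hbound : ∀ i, 0 ≤ m i ∧ m i ≤ d) :
    inCone PiGens (cls (d : ℝ) fun i => (m i : ℝ)) :=
  inCone_of_standard_form (fun i j h => Int.cast_le.2 (hsorted i j h)) (by exact_mod_cast hdeg)
    (Int.cast_le.2 (hbound 0).2) (Int.cast_nonneg (hbound 7).1)
end
end

section
/- One has W·Π ⊆ T, i.e. ⋃_{w∈W} w(Π) ⊆ ⋃_{w∈W} w(C̄). -/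
noncomputable section

/-- The null root `δ = 2H − ∑ E_i = −K/2` of the affine root system. -/
def nullRoot : V := fun j => if j = 0 then 2 else -1

/-- An integral vector in the interior of the fundamental chamber. -/
def interiorVec : V := ![12, -7, -6, -5, -4, -3, -2, -1, 0]

/-- The set of vectors with integer coordinates. -/
def integralSet : Set V := Set.range fun (z : Fin 9 → ℤ) j => (z j : ℝ)

lemma form_comm (x y : V) : form x y = form y x := by
  simp only [form, mul_comm, mul_left_comm]

lemma form_add_left (a x y : V) : form (x + y) a = form x a + form y a := by
  rw [form_comm, form_add_right, form_comm a, form_comm a]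

lemma form_smul_left (a : V) (c : ℝ) (x : V) : form (c • x) a = c * form x a := by
  rw [form_comm, form_smul_right, form_comm a]

lemma sEquiv_apply (i : Fin 8) (x : V) : sEquiv i x = x + form (α i) x • α i := rfl

lemma sEquiv_mem_W (i : Fin 8) : sEquiv i ∈ W :=
  Subgroup.subset_closure (Set.mem_range_self i)

lemma form_nullRoot_right (x : V) : form x nullRoot = 4 * x 0 + ∑ i : Fin 8, x i.succ := by
  simp [form, nullRoot]
  ring

lemma form_alpha_nullRoot (i : Fin 8) : form (α i) nullRoot = 0 := by
  rw [form_nullRoot_right, Fin.sum_univ_eight]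
  fin_cases i <;> simp +decide [α, Hv, Ev] <;> norm_num

lemma form_nullRoot_self : form nullRoot nullRoot = 0 := by
  rw [form_nullRoot_right]
  simp [nullRoot]
  norm_num

lemma form_alpha_interiorVec_pos (i : Fin 8) : 0 < form (α i) interiorVec := by
  fin_cases i <;>
    simp +decide [form, α, Hv, Ev, interiorVec, Fin.sum_univ_eight] <;> norm_num

lemma alpha_mem_integralSet (i : Fin 8) : α i ∈ integralSet := by
  unfold α
  split_ifs
  · exact ⟨![1, -1, -1, -1, -1, 0, 0, 0, 0], by
      ext j; fin_cases j <;> simp +decide [Hv, Ev]⟩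
  · exact ⟨fun j => (if j = (i - 1).succ then 1 else 0) - if j = i.succ then 1 else 0, by
      ext j; simp [Ev]⟩

lemma interiorVec_mem_integralSet : interiorVec ∈ integralSet :=
  ⟨![12, -7, -6, -5, -4, -3, -2, -1, 0], by ext j; fin_cases j <;> simp [interiorVec]⟩

lemma sEquiv_mem_integralSet (i : Fin 8) {x : V} (hx : x ∈ integralSet) :
    sEquiv i x ∈ integralSet := by
  obtain ⟨z, rfl⟩ := hx
  obtain ⟨a, ha⟩ := alpha_mem_integralSet i
  refine ⟨fun j => z j + (2 * a 0 * z 0 - ∑ k : Fin 8, a k.succ * z k.succ) * a j, ?_⟩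
  rw [sEquiv_apply, ← ha]
  ext j
  simp [form]

lemma sEquiv_sEquiv (i : Fin 8) (x : V) : sEquiv i (sEquiv i x) = x :=
  refl_refl _ (form_alpha_self i) x

lemma mem_integralSet_iff_of_mem_W {w : V ≃ₗ[ℝ] V} (hw : w ∈ W) :
    ∀ x, w x ∈ integralSet ↔ x ∈ integralSet := by
  induction hw using Subgroup.closure_induction with
  | mem w h =>
    obtain ⟨i, rfl⟩ := h
    intro x
    refine ⟨fun h => ?_, sEquiv_mem_integralSet i⟩
    simpa only [sEquiv_sEquiv] using sEquiv_mem_integralSet i h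
  | one => exact fun x => Iff.rfl
  | mul a b _ _ ha hb => exact fun x => (ha (b x)).trans (hb x)
  | inv a _ ha =>
    intro x
    rw [← ha (a⁻¹ x)]
    exact iff_of_eq (congrArg (· ∈ integralSet) (a.apply_symm_apply x))

lemma form_map_of_mem_W {w : V ≃ₗ[ℝ] V} (hw : w ∈ W) :
    ∀ x y, form (w x) (w y) = form x y := by
  induction hw using Subgroup.closure_induction with
  | mem w h =>
    obtain ⟨i, rfl⟩ := h
    intro x y
    simp only [sEquiv_apply, form_add_left, form_add_right, form_smul_left, form_smul_right,
      form_alpha_self, form_comm x (α i)]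
    ring
  | one => exact fun x y => rfl
  | mul a b _ _ ha hb => exact fun x y => (ha _ _).trans (hb x y)
  | inv a _ ha =>
    intro x y
    rw [← ha (a⁻¹ x)]
    exact congrArg₂ form (a.apply_symm_apply x) (a.apply_symm_apply y)

lemma map_nullRoot_of_mem_W {w : V ≃ₗ[ℝ] V} (hw : w ∈ W) : w nullRoot = nullRoot := by
  induction hw using Subgroup.closure_induction with
  | mem w h =>
    obtain ⟨i, rfl⟩ := h
    rw [sEquiv_apply, form_alpha_nullRoot, zero_smul, add_zero]
  | one => rfl
  | mul a b _ _ ha hb => exact (congrArg a hb).trans ha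
  | inv a _ ha => exact (LinearEquiv.symm_apply_eq a).2 ha.symm

/-- A vector of positive degree against the null root is bounded below, with bounded sublevel
sets, on the paraboloid of vectors of fixed positive degree `b` and fixed square `q`. -/
lemma exists_coord_bound {x : V} (hx : 0 < form x nullRoot) {b : ℝ} (hb : 0 < b) (q M : ℝ) :
    ∃ N : ℝ, ∀ y : V, form y nullRoot = b → form y y = q → form x y ≤ M →
      ∀ j, |y j| ≤ N := by
  have hdeg := form_nullRoot_right x
  set c := form x nullRoot
  set C : ℝ := b / c * ∑ i : Fin 8, x i.succ ^ 2
  set B : ℝ := 2 / c * (M - b / 2 * x 0 + C + c / (4 * b) * (b ^ 2 / 8 - q))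
  set R : ℝ := 2 * b * B + b ^ 2 / 8 - q
  refine ⟨b / 4 + 1 + R + 2 * (|B| + |b ^ 2 / 8 - q| / (2 * b)), fun y hy hyq hyM => ?_⟩
  rw [form_nullRoot_right] at hy
  obtain ⟨μ, hμ⟩ : ∃ μ, y 0 = b / 4 + 2 * μ := ⟨(y 0 - b / 4) / 2, by ring⟩
  simp only [form, hμ] at hyq hyM
  have hsum : ∑ i : Fin 8, y i.succ = -8 * μ := by linarith
  have hsq : ∑ i : Fin 8, (y i.succ + μ) ^ 2 = 2 * b * μ + b ^ 2 / 8 - q := by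
    have : ∑ i : Fin 8, (y i.succ + μ) ^ 2 =
        ∑ i : Fin 8, y i.succ * y i.succ + 2 * μ * ∑ i : Fin 8, y i.succ + 8 * μ ^ 2 := by
      simp only [Fin.sum_univ_eight]; ring
    rw [this, hsum]
    linarith
  have hcross : ∑ i : Fin 8, x i.succ * (y i.succ + μ) ≤
      C + c / (4 * b) * ∑ i : Fin 8, (y i.succ + μ) ^ 2 := by
    simp only [C]
    rw [Finset.mul_sum, Finset.mul_sum, ← Finset.sum_add_distrib]
    refine Finset.sum_le_sum fun i _ => ?_
    have : b / c * x i.succ ^ 2 + c / (4 * b) * (y i.succ + μ) ^ 2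
        - x i.succ * (y i.succ + μ) = b / c * (x i.succ - c / (2 * b) * (y i.succ + μ)) ^ 2 := by
      field_simp
      ring
    have : 0 ≤ b / c * (x i.succ - c / (2 * b) * (y i.succ + μ)) ^ 2 := by positivity
    linarith
  have hsplit : ∑ i : Fin 8, x i.succ * (y i.succ + μ) =
      ∑ i : Fin 8, x i.succ * y i.succ + μ * ∑ i : Fin 8, x i.succ := by
    rw [Finset.mul_sum, ← Finset.sum_add_distrib]
    exact Finset.sum_congr rfl fun i _ => by ring
  have hμB : μ ≤ B := by
    have hlin : c * μ ≤ M - b / 2 * x 0 + C + c / (4 * b) * (2 * b * μ + b ^ 2 / 8 - q) := by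
      rw [← hsq]
      have : c * μ = 4 * x 0 * μ + μ * ∑ i : Fin 8, x i.succ := by rw [hdeg]; ring
      linarith
    have hhalf : c / (4 * b) * (2 * b * μ + b ^ 2 / 8 - q) =
        c * μ / 2 + c / (4 * b) * (b ^ 2 / 8 - q) := by
      field_simp
      ring
    have : B = 2 / c * (M - b / 2 * x 0 + C + c / (4 * b) * (b ^ 2 / 8 - q)) := rfl
    rw [this, div_mul_eq_mul_div, le_div_iff₀ hx]
    linarith
  have hRμ : 2 * b * μ + b ^ 2 / 8 - q ≤ R := by
    have := mul_le_mul_of_nonneg_left hμB hb.le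
    simp only [R]
    linarith
  have hR : 0 ≤ R := (hsq ▸ Finset.sum_nonneg fun i _ => sq_nonneg _ :
    0 ≤ 2 * b * μ + b ^ 2 / 8 - q).trans hRμ
  have hμ' : -(|b ^ 2 / 8 - q| / (2 * b)) ≤ μ := by
    have h₀ : 0 ≤ 2 * b * μ + b ^ 2 / 8 - q := hsq ▸ Finset.sum_nonneg fun i _ => sq_nonneg _
    rw [← neg_div, div_le_iff₀ (by positivity)]
    linarith [le_abs_self (b ^ 2 / 8 - q)]
  have hpos : 0 ≤ |b ^ 2 / 8 - q| / (2 * b) := by positivity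
  set D := |b ^ 2 / 8 - q| / (2 * b)
  have hB := le_abs_self B
  have hB' := abs_nonneg B
  intro j
  refine Fin.cases ?_ (fun i => ?_) j
  · rw [hμ, abs_le]
    constructor <;> linarith
  · have hi : (y i.succ + μ) ^ 2 ≤ R := by
      refine le_trans ?_ (hsq.trans_le hRμ)
      exact Finset.single_le_sum (f := fun i : Fin 8 => (y i.succ + μ) ^ 2)
        (fun i _ => sq_nonneg _) (Finset.mem_univ i)
    have h₁ : y i.succ + μ ≤ 1 + R := by nlinarith
    have h₂ : -(1 + R) ≤ y i.succ + μ := by nlinarith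
    rw [abs_le]
    constructor <;> linarith

lemma finite_integral_sublevel {x : V} (hx : 0 < form x nullRoot) {b : ℝ} (hb : 0 < b)
    (q M : ℝ) :
    {y ∈ integralSet | form y nullRoot = b ∧ form y y = q ∧ form x y ≤ M}.Finite := by
  obtain ⟨N, hN⟩ := exists_coord_bound hx hb q M
  refine ((Set.finite_Icc (fun _ : Fin 9 => -⌈N⌉) (fun _ => ⌈N⌉)).image
    fun z j => (z j : ℝ)).subset ?_
  rintro _ ⟨⟨z, rfl⟩, h₁, h₂, h₃⟩
  have hz j : |z j| ≤ ⌈N⌉ := by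
    have : |(z j : ℝ)| ≤ ⌈N⌉ := (hN _ h₁ h₂ h₃ j).trans (Int.le_ceil N)
    exact_mod_cast this
  exact ⟨z, ⟨fun j => (abs_le.1 (hz j)).1, fun j => (abs_le.1 (hz j)).2⟩, rfl⟩

lemma exists_mem_W_image_Cbar {x : V} (hx : 0 < form x nullRoot) :
    ∃ w ∈ W, ∃ y ∈ Cbar, w y = x := by
  let S : Set V := {y | (∃ w ∈ W, w interiorVec = y) ∧ form x y ≤ form x interiorVec}
  have hb : 0 < form interiorVec nullRoot := by
    rw [form_nullRoot_right]
    simp +decide [interiorVec, Fin.sum_univ_eight]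
    norm_num
  have hfin : S.Finite := by
    refine (finite_integral_sublevel hx hb (form interiorVec interiorVec)
      (form x interiorVec)).subset ?_
    rintro _ ⟨⟨w, hw, rfl⟩, hle⟩
    refine ⟨(mem_integralSet_iff_of_mem_W hw _).2 interiorVec_mem_integralSet, ?_,
      form_map_of_mem_W hw _ _, hle⟩
    rw [← form_map_of_mem_W hw interiorVec, map_nullRoot_of_mem_W hw]
  obtain ⟨_, ⟨⟨w, hw, rfl⟩, hle⟩, hmin⟩ := Set.exists_min_image S (form x) hfin
    ⟨interiorVec, ⟨1, W.one_mem, rfl⟩, le_rfl⟩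
  refine ⟨w, hw, w.symm x, fun i => ?_, w.apply_symm_apply x⟩
  rw [← form_map_of_mem_W hw, w.apply_symm_apply]
  have hrefl : form x (w interiorVec) ≤ form x ((w * sEquiv i) interiorVec) := by
    rcases le_total (form x ((w * sEquiv i) interiorVec)) (form x interiorVec) with h | h
    · exact hmin _ ⟨⟨_, W.mul_mem hw (sEquiv_mem_W i), rfl⟩, h⟩
    · exact hle.trans h
  rw [LinearEquiv.mul_apply, sEquiv_apply, map_add, map_smul, form_add_right,
    form_smul_right] at hrefl
  exact nonneg_of_mul_nonneg_right (by linarith) (form_alpha_interiorVec_pos i)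

lemma PiGens_pos_or_eq_nullRoot {x : V} (hx : x ∈ PiGens) :
    0 < form x nullRoot ∨ x = nullRoot := by
  rw [form_nullRoot_right]
  rcases hx with (((rfl | ⟨i, hi, rfl⟩) | ⟨i, j, hij, hj, rfl⟩) | ⟨k, hk, hk', rfl⟩) |
    ⟨l, hl, hl', rfl⟩
  · left
    simp [Hv]
  · left
    simp [Hv, Ev, (Fin.succ_ne_zero _).symm]
  · left
    simp [Hv, Ev, (Fin.succ_ne_zero _).symm]
    norm_num
  · rcases hk'.eq_or_lt with rfl | hk'
    · right
      ext m
      fin_cases m <;> simp +decide [Hv, Ev, nullRoot, Fin.sum_univ_eight]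
    · left
      interval_cases k <;>
        simp +decide [Hv, Ev, Finset.sum_filter, Fin.sum_univ_eight] <;> norm_num
  · left
    interval_cases l <;>
      simp +decide [Hv, Ev, Finset.sum_filter, Fin.sum_univ_eight] <;> norm_num

lemma PiCone_pos_or_eq_smul_nullRoot {x : V} (hx : x ∈ PiCone) :
    0 < form x nullRoot ∨ ∃ a : ℝ, x = a • nullRoot := by
  obtain ⟨n, c, g, hc, hg, rfl⟩ := hx
  refine Finset.sum_induction _ (fun x => 0 < form x nullRoot ∨ ∃ a : ℝ, x = a • nullRoot)
    ?_ (Or.inr ⟨0, by simp⟩) ?_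
  · rintro x y (hx | ⟨a, rfl⟩) (hy | ⟨b, rfl⟩)
    · exact Or.inl (by rw [form_add_left]; positivity)
    · exact Or.inl (by simpa [form_add_left, form_smul_left, form_nullRoot_self] using hx)
    · exact Or.inl (by simpa [form_add_left, form_smul_left, form_nullRoot_self] using hy)
    · exact Or.inr ⟨a + b, (add_smul _ _ _).symm⟩
  · intro i _
    rcases PiGens_pos_or_eq_nullRoot (hg i) with h | h
    · rcases (hc i).eq_or_lt with h0 | h0
      · exact Or.inr ⟨0, by rw [← h0, zero_smul, zero_smul]⟩
      · exact Or.inl (by rw [form_smul_left]; positivity)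
    · exact Or.inr ⟨c i, by rw [h]⟩

/-- **Lemma `lem:wPiinT`:** `W·Π ⊆ T`, i.e.
`⋃_{w∈W} w(Π) ⊆ ⋃_{w∈W} w(C̄)` (the Tits cone). -/
theorem WPi_subset_Tits :
    (⋃ w ∈ W, (w : V ≃ₗ[ℝ] V) '' PiCone) ⊆ ⋃ w ∈ W, (w : V ≃ₗ[ℝ] V) '' Cbar := by
  intro x hx
  simp only [Set.mem_iUnion] at hx ⊢
  obtain ⟨w, hw, p, hp, rfl⟩ := hx
  rcases PiCone_pos_or_eq_smul_nullRoot hp with h | ⟨a, rfl⟩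
  · obtain ⟨v, hv, y, hy, rfl⟩ := exists_mem_W_image_Cbar h
    exact ⟨w * v, W.mul_mem hw hv, y, hy, rfl⟩
  · exact ⟨w, hw, a • nullRoot, fun i => by
      rw [form_comm, form_smul_right, form_alpha_nullRoot, mul_zero], rfl⟩
end
end

section
/- The vector 2H − Σ_{i=1}^8 E_i (the class −½K) is not contained in the convex cone generated by the orbit W·E_8 = { w(E_8) : w ∈ W }. -/
noncomputable section

lemma form_antiK_alpha (i : Fin 8) :
    form ((2 : ℝ) • Hv - ∑ j : Fin 8, Ev j) (α i) = 0 := by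
  fin_cases i <;>
    simp +decide [form, α, Hv, Ev, Fin.sum_univ_eight] <;> norm_num

lemma form_antiK_self :
    form ((2 : ℝ) • Hv - ∑ j : Fin 8, Ev j) ((2 : ℝ) • Hv - ∑ j : Fin 8, Ev j) = 0 := by
  simp +decide [form, Hv, Ev, Fin.sum_univ_eight]; norm_num

lemma form_antiK_E8 : form ((2 : ℝ) • Hv - ∑ j : Fin 8, Ev j) (Ev 7) = 1 := by
  simp +decide [form, Hv, Ev, Fin.sum_univ_eight]

lemma form_sum_right (a : V) {n : ℕ} (c : Fin n → ℝ) (g : Fin n → V) :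
    form a (∑ i, c i • g i) = ∑ i, c i * form a (g i) := by
  let f : V →ₗ[ℝ] ℝ :=
    { toFun := form a
      map_add' := form_add_right a
      map_smul' := form_smul_right a }
  change f (∑ i, c i • g i) = ∑ i, c i * f (g i)
  simp

/-- The functional `(−½K, ·)` is invariant under the Weyl group. -/
lemma form_antiK_weyl {w : V ≃ₗ[ℝ] V} (hw : w ∈ W) (x : V) :
    form ((2 : ℝ) • Hv - ∑ j : Fin 8, Ev j) (w x)
      = form ((2 : ℝ) • Hv - ∑ j : Fin 8, Ev j) x := by
  have reflection (i : Fin 8) (y : V) :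
      form ((2 : ℝ) • Hv - ∑ j : Fin 8, Ev j) (sEquiv i y)
        = form ((2 : ℝ) • Hv - ∑ j : Fin 8, Ev j) y := by
    change form _ (y + form (α i) y • α i) = _
    rw [form_add_right, form_smul_right, form_antiK_alpha, mul_zero, add_zero]
  induction hw using Subgroup.closure_induction generalizing x with
  | mem w h =>
    obtain ⟨i, rfl⟩ := h
    exact reflection i x
  | one => rfl
  | mul u v _ _ hu hv => exact (hu (v x)).trans (hv x)
  | inv u _ hu =>
    rw [← hu (u⁻¹ x)]
    exact congrArg _ (u.apply_symm_apply x)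

/-- **Lemma:** the class `−½K = 2H − ∑_{i=1}^{8} E_i` is not contained in the convex
cone generated by the orbit `W·E_8`. -/
theorem antiK_not_in_orbit_cone :
    ¬ inCone orbitE8 ((2 : ℝ) • Hv - ∑ i : Fin 8, Ev i) := by
  rintro ⟨n, c, g, hc, hg, hx⟩
  have pairing_one (i : Fin n) : form ((2 : ℝ) • Hv - ∑ j : Fin 8, Ev j) (g i) = 1 := by
    obtain ⟨w, hw, hi⟩ := hg i
    rw [hi, form_antiK_weyl hw, form_antiK_E8]
  have sum_eq_zero : ∑ i, c i = 0 := by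
    rw [← form_antiK_self]
    conv_rhs => rw [hx, form_sum_right, ← hx]
    simp [pairing_one]
  have coeff_eq_zero : ∀ i, c i = 0 := fun i =>
    (Finset.sum_eq_zero_iff_of_nonneg fun i _ => hc i).1 sum_eq_zero i (Finset.mem_univ i)
  have degree_eq := congrFun hx 0
  simp +decide [coeff_eq_zero, Hv, Ev, Fin.sum_univ_eight] at degree_eq
end
end

section
/- The set of elements of the orbit W·E_8 = { w(E_8) : w ∈ W } whose coefficient of H is at most 2 is exactly the set consisting of: the vectors E_i for 1 ≤ i ≤ 8; the vectors H − E_i − E_j − E_k for pairwise distinct i, j, k ∈ {1,…,8}; and the vectors 2H − 2E_i − Σ_{j∈J} E_j for i ∈ {1,…,8} and J ⊆ {1,…,8} \ {i} with |J| = 5. -/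
noncomputable section

/-- The action of a permutation of `E_1, …, E_8` on `V`, fixing `H`. -/
def permV (σ : Equiv.Perm (Fin 8)) : V →ₗ[ℝ] V where
  toFun x := Fin.cons (x 0) fun i => x (σ.symm i).succ
  map_add' x y := by ext j; cases j using Fin.cases <;> simp
  map_smul' c x := by ext j; cases j using Fin.cases <;> simp

@[simp] lemma permV_apply_zero (σ : Equiv.Perm (Fin 8)) (x : V) : permV σ x 0 = x 0 := rfl

@[simp] lemma permV_apply_succ (σ : Equiv.Perm (Fin 8)) (x : V) (i : Fin 8) :
    permV σ x i.succ = x (σ.symm i).succ := rfl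

@[simp] lemma Hv_zero : Hv 0 = 1 := by simp [Hv]

@[simp] lemma Hv_succ (i : Fin 8) : Hv i.succ = 0 := by simp [Hv]

@[simp] lemma Ev_zero (i : Fin 8) : Ev i 0 = 0 := by
  simp [Ev, (Fin.succ_ne_zero i).symm]

@[simp] lemma Ev_succ (i j : Fin 8) : Ev i j.succ = if j = i then 1 else 0 := by
  simp [Ev]

@[simp] lemma Kv_zero : Kv 0 = -4 := by simp [Kv]

@[simp] lemma Kv_succ (i : Fin 8) : Kv i.succ = 2 := by simp [Kv]

lemma V_ext {x y : V} (h0 : x 0 = y 0) (h : ∀ i : Fin 8, x i.succ = y i.succ) : x = y :=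
  funext (Fin.cases h0 h)

@[simp] lemma permV_Hv (σ : Equiv.Perm (Fin 8)) : permV σ Hv = Hv :=
  V_ext (by simp) (by simp)

@[simp] lemma permV_Ev (σ : Equiv.Perm (Fin 8)) (i : Fin 8) : permV σ (Ev i) = Ev (σ i) :=
  V_ext (by simp) (by simp [Equiv.symm_apply_eq])

lemma alpha_succ (j : Fin 7) : α j.succ = Ev j.castSucc - Ev j.succ := by
  fin_cases j <;> rfl

lemma form_Ev_left (i : Fin 8) (x : V) : form (Ev i) x = -x i.succ := by
  simp [form]

lemma form_sub_left (x y z : V) : form (x - y) z = form x z - form y z := by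
  rw [form_comm, sub_eq_add_neg, ← neg_one_smul ℝ y, form_add_right, form_smul_right,
    form_comm z, form_comm z]
  ring

lemma form_alpha_zero (x : V) :
    form (α 0) x = 2 * x 0 + x 1 + x 2 + x 3 + x 4 := by
  have h : form Hv x = 2 * x 0 := by simp [form]
  simp only [α, if_true, form_sub_left, form_Ev_left, h]
  simp

lemma form_alpha_succ (j : Fin 7) (x : V) :
    form (α j.succ) x = x j.succ.succ - x j.castSucc.succ := by
  rw [alpha_succ, form_sub_left, form_Ev_left, form_Ev_left]
  ring

lemma sEquiv_succ_apply (j : Fin 7) (x : V) :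
    sEquiv j.succ x = permV (Equiv.swap j.castSucc j.succ) x := by
  rw [sEquiv_apply, form_alpha_succ, alpha_succ]
  refine V_ext (by simp) fun i => ?_
  have hj : j.castSucc ≠ j.succ := Fin.castSucc_lt_succ.ne
  rw [permV_apply_succ, Equiv.symm_swap, Equiv.swap_apply_def]
  split_ifs with h1 h2
  · simp [h1, hj]
  · simp [h2, hj.symm]
  · simp [h1, h2]

lemma sEquiv_mem_orbitE8 (i : Fin 8) {x : V} (hx : x ∈ orbitE8) : sEquiv i x ∈ orbitE8 := by
  obtain ⟨w, hw, rfl⟩ := hx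
  exact ⟨sEquiv i * w, W.mul_mem (Subgroup.subset_closure ⟨i, rfl⟩) hw, rfl⟩

lemma permV_mem_orbitE8 (σ : Equiv.Perm (Fin 8)) {x : V} (hx : x ∈ orbitE8) :
    permV σ x ∈ orbitE8 := by
  have hσ : σ ∈ Submonoid.closure
      (Set.range fun i : Fin 7 => Equiv.swap i.castSucc i.succ) := by
    rw [Equiv.Perm.mclosure_swap_castSucc_succ]; trivial
  induction hσ using Submonoid.closure_induction generalizing x with
  | mem σ h =>
    obtain ⟨j, rfl⟩ := h
    rw [← sEquiv_succ_apply]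
    exact sEquiv_mem_orbitE8 _ hx
  | one => exact (V_ext rfl fun _ => rfl : permV 1 x = x) ▸ hx
  | mul σ τ _ _ hσ hτ =>
    exact (V_ext rfl fun _ => rfl : permV (σ * τ) x = permV σ (permV τ x)) ▸ hσ (hτ hx)

lemma Ev_mem_orbitE8 (i : Fin 8) : Ev i ∈ orbitE8 := by
  have h : Ev 7 ∈ orbitE8 := ⟨1, W.one_mem, rfl⟩
  simpa using permV_mem_orbitE8 (Equiv.swap 7 i) h

lemma exists_perm_extending {n : ℕ} {f g : Fin n → Fin 8}
    (hf : Function.Injective f) (hg : Function.Injective g) :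
    ∃ σ : Equiv.Perm (Fin 8), ∀ i, σ (f i) = g i := by
  have := Equiv.Perm.isMultiplyPretransitive (Fin 8) n
  obtain ⟨σ, h⟩ := MulAction.exists_smul_eq (Equiv.Perm (Fin 8))
    (⟨f, hf⟩ : Fin n ↪ Fin 8) ⟨g, hg⟩
  exact ⟨σ, fun i => DFunLike.congr_fun h i⟩

lemma sEquiv_zero_Ev_three : sEquiv 0 (Ev 3) = Hv - Ev 0 - Ev 1 - Ev 2 := by
  have h : form (α 0) (Ev 3) = 1 := by rw [form_alpha_zero]; simp [Ev]
  rw [sEquiv_apply, h, α, if_pos rfl]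
  module

lemma degree_one_mem_orbitE8 {i j k : Fin 8} (hij : i ≠ j) (hik : i ≠ k) (hjk : j ≠ k) :
    Hv - Ev i - Ev j - Ev k ∈ orbitE8 := by
  have h := sEquiv_mem_orbitE8 0 (Ev_mem_orbitE8 3)
  rw [sEquiv_zero_Ev_three] at h
  obtain ⟨σ, hσ⟩ := exists_perm_extending (f := ![0, 1, 2]) (g := ![i, j, k])
    (by decide) (by
      intro a b
      fin_cases a <;> fin_cases b <;> simp [hij, hik, hjk, hij.symm, hik.symm, hjk.symm])
  have h0 : σ 0 = i := hσ 0
  have h1 : σ 1 = j := hσ 1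
  have h2 : σ 2 = k := hσ 2
  simpa [h0, h1, h2] using permV_mem_orbitE8 σ h

lemma sEquiv_zero_degree_one :
    sEquiv 0 (Hv - Ev 0 - Ev 4 - Ev 5) =
      (2 : ℝ) • Hv - (2 : ℝ) • Ev 0 - (Ev 1 + Ev 2 + Ev 3 + Ev 4 + Ev 5) := by
  have h : form (α 0) (Hv - Ev 0 - Ev 4 - Ev 5) = 1 := by
    rw [form_alpha_zero]; simp [Ev, Hv]; norm_num
  rw [sEquiv_apply, h, α, if_pos rfl]
  module

lemma degree_two_mem_orbitE8 {i : Fin 8} {J : Finset (Fin 8)} (hi : i ∉ J) (hJ : J.card = 5) :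
    (2 : ℝ) • Hv - (2 : ℝ) • Ev i - ∑ j ∈ J, Ev j ∈ orbitE8 := by
  have h := sEquiv_mem_orbitE8 0
    (degree_one_mem_orbitE8 (i := 0) (j := 4) (k := 5) (by decide) (by decide) (by decide))
  rw [sEquiv_zero_degree_one] at h
  let e := J.orderEmbOfFin hJ
  obtain ⟨σ, hσ⟩ := exists_perm_extending (f := ![0, 1, 2, 3, 4, 5]) (g := Fin.cons i e)
    (by decide) (Fin.cons_injective_iff.2 ⟨by simpa [e] using hi, e.injective⟩)
  have hs : ∑ j ∈ J, Ev j = Ev (e 0) + Ev (e 1) + Ev (e 2) + Ev (e 3) + Ev (e 4) := by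
    rw [← Fin.sum_univ_five fun a => Ev (e a), ← Finset.map_orderEmbOfFin_univ J hJ,
      Finset.sum_map]
    rfl
  have h0 : σ 0 = i := hσ 0
  have h1 : σ 1 = e 0 := hσ 1
  have h2 : σ 2 = e 1 := hσ 2
  have h3 : σ 3 = e 2 := hσ 3
  have h4 : σ 4 = e 3 := hσ 4
  have h5 : σ 5 = e 4 := hσ 5
  simpa [h0, h1, h2, h3, h4, h5, hs] using permV_mem_orbitE8 σ h

/-- The integral classes with the same numerical invariants as the exceptional classes `E_i`. -/
def IsNumExceptional (x : V) : Prop :=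
  (∀ j, ∃ n : ℤ, x j = n) ∧ form x x = -1 ∧ form Kv x = -2

lemma IsNumExceptional.sEquiv {x : V} (hx : IsNumExceptional x) (i : Fin 8) :
    IsNumExceptional (sEquiv i x) := by
  obtain ⟨hint, hself, hK⟩ := hx
  have hα : ∀ j, ∃ n : ℤ, α i j = n := by
    intro j
    cases i using Fin.cases with
    | zero =>
      refine ⟨(![1, -1, -1, -1, -1, 0, 0, 0, 0] : Fin 9 → ℤ) j, ?_⟩
      fin_cases j <;> simp +decide [α, Hv, Ev]
    | succ i =>
      refine ⟨(if j = i.castSucc.succ then 1 else 0) - (if j = i.succ.succ then 1 else 0), ?_⟩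
      rw [alpha_succ]
      simp [Ev]
  choose a ha using hα
  choose n hn using hint
  have hform : form (α i) x = ((2 * a 0 * n 0 - ∑ k : Fin 8, a k.succ * n k.succ : ℤ) : ℝ) := by
    simp [form, ha, hn]
  have hKα : form Kv (α i) = 0 := by
    rw [form_comm]
    cases i using Fin.cases with
    | zero =>
      rw [form_alpha_zero, Kv_zero, show Kv 1 = 2 from Kv_succ 0, show Kv 2 = 2 from Kv_succ 1,
        show Kv 3 = 2 from Kv_succ 2, show Kv 4 = 2 from Kv_succ 3]
      norm_num
    | succ i => rw [form_alpha_succ, Kv_succ, Kv_succ, sub_self]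
  refine ⟨fun j => ⟨n j + (2 * a 0 * n 0 - ∑ k : Fin 8, a k.succ * n k.succ) * a j, ?_⟩, ?_, ?_⟩
  · rw [sEquiv_apply, hform]
    simp [ha, hn]
  · rw [sEquiv_apply, form_add_right, form_smul_right, form_comm _ x, form_comm _ (α i),
      form_add_right, form_smul_right, form_add_right, form_smul_right, form_alpha_self,
      form_comm x (α i), hself]
    ring
  · rw [sEquiv_apply, form_add_right, form_smul_right, hKα, hK]
    ring

lemma isNumExceptional_apply_iff {w : V ≃ₗ[ℝ] V} (hw : w ∈ W) (x : V) :
    IsNumExceptional (w x) ↔ IsNumExceptional x := by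
  induction hw using Subgroup.closure_induction generalizing x with
  | mem w h =>
    obtain ⟨i, rfl⟩ := h
    refine ⟨fun h => ?_, fun h => h.sEquiv i⟩
    have h' := h.sEquiv i
    rwa [show sEquiv i (sEquiv i x) = x from refl_refl _ (form_alpha_self i) x] at h'
  | one => rfl
  | mul v w _ _ hv hw => exact (hv (w x)).trans (hw x)
  | inv w _ h =>
    rw [← h (w⁻¹ x), show w (w⁻¹ x) = x from w.apply_symm_apply x]

lemma isNumExceptional_of_mem_orbitE8 {x : V} (hx : x ∈ orbitE8) : IsNumExceptional x := by
  obtain ⟨w, hw, rfl⟩ := hx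
  rw [isNumExceptional_apply_iff hw]
  refine ⟨fun j => ⟨if j = (7 : Fin 8).succ then 1 else 0, by simp [Ev]⟩, ?_, ?_⟩
  · rw [form_Ev_left, Ev_succ, if_pos rfl]
  · rw [form_comm, form_Ev_left, Kv_succ]

/-- The numerical invariants in terms of degree and multiplicities. -/
lemma IsNumExceptional.exists_int {x : V} (hx : IsNumExceptional x) :
    ∃ (d : ℤ) (m : Fin 8 → ℤ), x 0 = d ∧ (∀ i, x i.succ = -m i) ∧
      ∑ i, m i = 4 * d - 1 ∧ ∑ i, m i ^ 2 = 2 * d ^ 2 + 1 := by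
  obtain ⟨hint, hself, hK⟩ := hx
  choose n hn using hint
  refine ⟨n 0, fun i => -n i.succ, hn 0, fun i => by simp [hn], ?_, ?_⟩
  · have h : form Kv x = -8 * x 0 - 2 * ∑ i : Fin 8, x i.succ := by
      simp only [form, Kv_zero, Kv_succ, Finset.mul_sum]
      norm_num
    rw [hK] at h
    simp only [hn] at h
    have h' : (-2 : ℤ) = -8 * n 0 - 2 * ∑ i : Fin 8, n i.succ := by exact_mod_cast h
    rw [Finset.sum_neg_distrib]
    lia
  · simp only [form, hn] at hself
    have h' : 2 * n 0 * n 0 - ∑ i : Fin 8, n i.succ * n i.succ = -1 := by exact_mod_cast hself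
    simp only [pow_two, neg_mul_neg]
    lia

lemma degree_nonneg {d : ℤ} {m : Fin 8 → ℤ} (h1 : ∑ i, m i = 4 * d - 1)
    (h2 : ∑ i, m i ^ 2 = 2 * d ^ 2 + 1) : 0 ≤ d := by
  have h := sq_sum_le_card_mul_sum_sq (s := Finset.univ) (f := m)
  rw [h1, h2] at h
  simp at h
  nlinarith

lemma eq_zero_or_one_of_mul_sub_one {n : ℤ} (h : n * (n - 1) = 0) : n = 0 ∨ n = 1 := by
  rcases mul_eq_zero.1 h with h | h <;> lia

lemma mul_sub_one_nonneg (n : ℤ) : 0 ≤ n * (n - 1) := by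
  rcases le_or_gt n 0 with h | h <;> nlinarith

lemma exists_eq_Ev {m : Fin 8 → ℤ} (h1 : ∑ i, m i = -1) (h2 : ∑ i, m i ^ 2 = 1) :
    ∃ i, ∀ j, m j = if j = i then -1 else 0 := by
  obtain ⟨i, hi⟩ : ∃ i, m i ≠ 0 := by
    by_contra! h
    simp [h] at h1
  have hsplit := Finset.add_sum_erase Finset.univ (fun j => m j ^ 2) (Finset.mem_univ i)
  have hpos : 0 < m i ^ 2 := by positivity
  have hnn : ∀ j ∈ Finset.univ.erase i, 0 ≤ m j ^ 2 := fun j _ => sq_nonneg _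
  have hz := (Finset.sum_eq_zero_iff_of_nonneg hnn).1
    (le_antisymm (by lia) (Finset.sum_nonneg hnn))
  have hz' : ∀ j, j ≠ i → m j = 0 := fun j hj => by simpa using hz j (by simp [hj])
  rw [Finset.sum_eq_single i (fun j _ hj => hz' j hj) (by simp)] at h1
  refine ⟨i, fun j => ?_⟩
  split_ifs with h
  · rw [h, h1]
  · exact hz' j h

lemma exists_eq_indicator {m : Fin 8 → ℤ} (h1 : ∑ i, m i = 3) (h2 : ∑ i, m i ^ 2 = 3) :
    ∃ J : Finset (Fin 8), J.card = 3 ∧ ∀ j, m j = if j ∈ J then 1 else 0 := by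
  have hs : ∑ i, m i * (m i - 1) = 0 := by
    simp only [mul_sub_one, ← pow_two, Finset.sum_sub_distrib, h1, h2]; rfl
  have hz := (Finset.sum_eq_zero_iff_of_nonneg fun i _ => mul_sub_one_nonneg (m i)).1 hs
  have hm : ∀ j, m j = if j ∈ Finset.univ.filter (m · = 1) then 1 else 0 := fun j => by
    rcases eq_zero_or_one_of_mul_sub_one (hz j (Finset.mem_univ j)) with h | h <;> simp [h]
  refine ⟨_, ?_, hm⟩
  rw [Finset.sum_congr rfl fun j _ => hm j] at h1
  simp only [Finset.sum_ite_mem, Finset.univ_inter, Finset.sum_const, nsmul_eq_mul, mul_one] at h1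
  exact_mod_cast h1

lemma exists_eq_two_indicator {m : Fin 8 → ℤ} (h1 : ∑ i, m i = 7) (h2 : ∑ i, m i ^ 2 = 9) :
    ∃ (i : Fin 8) (J : Finset (Fin 8)), i ∉ J ∧ J.card = 5 ∧
      ∀ j, m j = (if j = i then 2 else 0) + if j ∈ J then 1 else 0 := by
  have hs : ∑ i, m i * (m i - 1) = 2 := by
    simp only [mul_sub_one, ← pow_two, Finset.sum_sub_distrib, h1, h2]; rfl
  obtain ⟨i, hi⟩ : ∃ i, m i * (m i - 1) ≠ 0 := by
    by_contra! h
    simp [h] at hs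
  have hsplit := Finset.add_sum_erase Finset.univ (fun j => m j * (m j - 1)) (Finset.mem_univ i)
  have hge : 2 ≤ m i * (m i - 1) := by
    have h0 : m i ≠ 0 := fun h => hi (by simp [h])
    have h1 : m i ≠ 1 := fun h => hi (by simp [h])
    rcases lt_or_gt_of_ne h0 with h | h
    · nlinarith
    · nlinarith [show 2 ≤ m i by lia]
  have hnn : ∀ j ∈ Finset.univ.erase i, 0 ≤ m j * (m j - 1) := fun j _ => mul_sub_one_nonneg _
  have hz := (Finset.sum_eq_zero_iff_of_nonneg hnn).1
    (le_antisymm (by lia) (Finset.sum_nonneg hnn))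
  have hi2 : m i * (m i - 1) = 2 := by
    rw [Finset.sum_eq_zero hz] at hsplit
    simpa using hsplit.trans hs
  set J := (Finset.univ.erase i).filter (m · = 1) with hJ
  have hm : ∀ j ∈ Finset.univ.erase i, m j = if j ∈ J then 1 else 0 := fun j hj => by
    have hj' : j ≠ i := Finset.ne_of_mem_erase hj
    rcases eq_zero_or_one_of_mul_sub_one (hz j hj) with h | h <;> simp [hJ, h, hj']
  have hiJ : i ∉ J := by simp [hJ]
  have hsum : m i + J.card = 7 := by
    rw [← h1, ← Finset.add_sum_erase Finset.univ m (Finset.mem_univ i),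
      Finset.sum_congr rfl hm, Finset.sum_ite_mem,
      Finset.inter_eq_right.2 (Finset.filter_subset _ _)]
    simp [hJ]
  have hcard : J.card ≤ 7 := (Finset.card_le_card (Finset.filter_subset _ _)).trans (by simp)
  have hmi : m i = 2 := by nlinarith
  refine ⟨i, J, hiJ, by lia, fun j => ?_⟩
  by_cases h : j = i
  · simp [h, hmi, hiJ]
  · simpa [h] using hm j (by simp [h])

/-- **Table 1:** the elements of the orbit `W·E_8` whose coefficient of `H` is at
most `2` are exactly: the `E_i`; the `H − E_i − E_j − E_k` for pairwise distinct
`i, j, k`; and the `2H − 2E_i − ∑_{j∈J} E_j` for `i ∉ J`, `|J| = 5`. -/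
theorem orbit_elements_up_to_degree_two :
    {x | x ∈ orbitE8 ∧ x 0 ≤ 2} =
      {x : V | (∃ i : Fin 8, x = Ev i) ∨
        (∃ i j k : Fin 8, i ≠ j ∧ i ≠ k ∧ j ≠ k ∧ x = Hv - Ev i - Ev j - Ev k) ∨
        (∃ (i : Fin 8) (J : Finset (Fin 8)), i ∉ J ∧ J.card = 5 ∧
          x = (2 : ℝ) • Hv - (2 : ℝ) • Ev i - ∑ j ∈ J, Ev j)} := by
  ext x
  constructor
  · rintro ⟨hx, hx2⟩
    obtain ⟨d, m, hd, hm, h1, h2⟩ := (isNumExceptional_of_mem_orbitE8 hx).exists_int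
    have hd0 := degree_nonneg h1 h2
    have hd2 : d ≤ 2 := by rw [hd] at hx2; exact_mod_cast hx2
    interval_cases d
    · obtain ⟨i, hi⟩ := exists_eq_Ev h1 h2
      exact Or.inl ⟨i, V_ext (by simp [hd]) fun j => by simp [hm, hi, apply_ite]⟩
    · obtain ⟨J, hJ, hmJ⟩ := exists_eq_indicator h1 h2
      obtain ⟨i, j, k, hij, hik, hjk, rfl⟩ := Finset.card_eq_three.1 hJ
      refine Or.inr (Or.inl ⟨i, j, k, hij, hik, hjk, V_ext (by simp [hd]) fun l => ?_⟩)
      rw [hm, hmJ]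
      simp only [Finset.mem_insert, Finset.mem_singleton, Pi.sub_apply, Hv_succ, Ev_succ]
      split_ifs <;> simp_all
    · obtain ⟨i, J, hi, hJ, hmJ⟩ := exists_eq_two_indicator h1 h2
      refine Or.inr (Or.inr ⟨i, J, hi, hJ, V_ext (by simp [hd]) fun l => ?_⟩)
      rw [hm, hmJ]
      simp [Finset.sum_apply]
      ring
  · rintro (⟨i, rfl⟩ | ⟨i, j, k, hij, hik, hjk, rfl⟩ | ⟨i, J, hi, hJ, rfl⟩)
    · exact ⟨Ev_mem_orbitE8 i, by simp⟩
    · exact ⟨degree_one_mem_orbitE8 hij hik hjk, by simp⟩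
    · exact ⟨degree_two_mem_orbitE8 hi hJ, by simp [Finset.sum_apply]⟩
end
end

section
/- Every integer class D = (d; m_1, …, m_8) in standard form with d ≥ m_1 and m_8 ≥ 0 lies in the convex cone generated by the orbit W·E_8 = { w(E_8) : w ∈ W } together with the vector 2H − Σ_{i=1}^8 E_i. -/
noncomputable section

lemma inCone_of_mem_span {S : Set V} {x : V} (hx : x ∈ Submodule.span NNReal S) :
    inCone S x := by
  obtain ⟨n, c, g, rfl⟩ := Submodule.mem_span_set'.1 hx
  exact ⟨n, fun i => c i, fun i => g i, fun i => (c i).2, fun i => (g i).2, rfl⟩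

lemma smul_mem_of_nonneg (P : Submodule NNReal V) {c : ℝ} (hc : 0 ≤ c) {x : V} (hx : x ∈ P) :
    c • x ∈ P :=
  P.smul_mem (⟨c, hc⟩ : NNReal) hx

lemma orbitE8_reflection {x : V} (i : Fin 8) (hx : x ∈ orbitE8) :
    x + form (α i) x • α i ∈ orbitE8 := by
  obtain ⟨w, hw, rfl⟩ := hx
  exact ⟨sEquiv i * w, W.mul_mem (Subgroup.subset_closure ⟨i, rfl⟩) hw, rfl⟩

/-- The orbit is stable under permutations of the exceptional classes. -/
lemma orbitE8_perm (σ : Equiv.Perm (Fin 8)) {x : V} (hx : x ∈ orbitE8) :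
    (Fin.cons (x 0) fun i => x (σ i).succ : V) ∈ orbitE8 := by
  have hσ : σ ∈ Submonoid.closure
      (Set.range fun i : Fin 7 => Equiv.swap i.castSucc i.succ) := by
    rw [Equiv.Perm.mclosure_swap_castSucc_succ]
    trivial
  induction hσ using Submonoid.closure_induction generalizing x with
  | mem τ hτ =>
    obtain ⟨i, rfl⟩ := hτ
    convert orbitE8_reflection i.succ hx using 1
    have hα : α i.succ = Ev i.castSucc - Ev i.succ := by
      fin_cases i <;> rfl
    have hform : form (α i.succ) x = x i.succ.succ - x i.castSucc.succ := by
      simp [hα, form, Ev, sub_mul, Finset.sum_sub_distrib, (Fin.succ_ne_zero _).symm]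
    have hne : i.castSucc ≠ i.succ := i.castSucc_lt_succ.ne
    ext j
    refine Fin.cases ?_ (fun k => ?_) j
    · simp [hα, Ev, (Fin.succ_ne_zero _).symm]
    · rw [hform, hα, Fin.cons_succ, Equiv.swap_apply_def]
      simp only [Ev, Pi.add_apply, Pi.smul_apply, Pi.sub_apply, Fin.succ_inj, smul_eq_mul]
      split_ifs <;> simp_all
  | one =>
    convert hx using 1
    ext j
    refine Fin.cases ?_ (fun i => ?_) j <;> simp
  | mul σ τ _ _ ihσ ihτ => simpa using ihτ (ihσ hx)

/-- The class of the plane through the points `i`, `j`, `k`. -/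
def planeClass (i j k : Fin 8) : V := Hv - Ev i - Ev j - Ev k

lemma planeClass_perm {i j k : Fin 8} (σ : Equiv.Perm (Fin 8))
    (h : planeClass (σ i) (σ j) (σ k) ∈ orbitE8) : planeClass i j k ∈ orbitE8 := by
  convert orbitE8_perm σ h using 1
  ext l
  refine Fin.cases ?_ (fun l => ?_) l <;> simp [planeClass, Hv, Ev, (Fin.succ_ne_zero _).symm]

lemma planeClass_zero_one_two_mem_orbitE8 : planeClass 0 1 2 ∈ orbitE8 := by
  convert orbitE8_reflection 0 (Ev_mem_orbitE8 3) using 1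
  ext j
  fin_cases j <;> simp +decide [planeClass, form, α, Hv, Ev, Fin.sum_univ_eight]

lemma planeClass_zero_four_five_mem_orbitE8 : planeClass 0 4 5 ∈ orbitE8 := by
  apply planeClass_perm (Equiv.swap 1 4 * Equiv.swap 2 5)
  convert planeClass_zero_one_two_mem_orbitE8 using 2 <;> decide

lemma planeClass_zero_six_seven_mem_orbitE8 : planeClass 0 6 7 ∈ orbitE8 := by
  apply planeClass_perm (Equiv.swap 1 6 * Equiv.swap 2 7)
  convert planeClass_zero_one_two_mem_orbitE8 using 2 <;> decide

/-- The quadric cone with vertex at the first point through the next five lies in the orbit. -/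
lemma quadricCone_mem_orbitE8 :
    (2 : ℝ) • Hv - (2 : ℝ) • Ev 0 - Ev 1 - Ev 2 - Ev 3 - Ev 4 - Ev 5 ∈ orbitE8 := by
  convert orbitE8_reflection 0 planeClass_zero_four_five_mem_orbitE8 using 1
  ext j
  fin_cases j <;> simp +decide [planeClass, form, α, Hv, Ev, Fin.sum_univ_eight] <;> norm_num

/-- The cone generated by the orbit of `E_8` and `2H - ∑ E_i`, as an `ℝ≥0`-submodule. -/
def effCone : Submodule NNReal V :=
  Submodule.span NNReal (orbitE8 ∪ {(2 : ℝ) • Hv - ∑ i : Fin 8, Ev i})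

lemma orbitE8_subset_effCone {x : V} (hx : x ∈ orbitE8) : x ∈ effCone :=
  Submodule.subset_span (Or.inl hx)

lemma Ev_mem_effCone (i : Fin 8) : Ev i ∈ effCone :=
  orbitE8_subset_effCone (Ev_mem_orbitE8 i)

/-- Lowering multiplicities keeps a class in the cone. -/
lemma cls_mem_effCone_of_le {d : ℝ} {m m' : Fin 8 → ℝ} (hle : m' ≤ m)
    (h : cls d m ∈ effCone) : cls d m' ∈ effCone := by
  have key : cls d m' = cls d m + ∑ i, (m i - m' i) • Ev i := by
    simp only [cls, sub_smul, Finset.sum_sub_distrib]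
    abel
  rw [key]
  exact effCone.add_mem h (effCone.sum_mem fun i _ =>
    smul_mem_of_nonneg _ (sub_nonneg.2 (hle i)) (Ev_mem_effCone i))

lemma cls_add (d d' : ℝ) (m m' : Fin 8 → ℝ) : cls (d + d') (m + m') = cls d m + cls d' m' := by
  simp only [cls, Pi.add_apply, add_smul, Finset.sum_add_distrib]
  abel

lemma cls_smul (c d : ℝ) (m : Fin 8 → ℝ) : cls (c * d) (c • m) = c • cls d m := by
  simp only [cls, Pi.smul_apply, smul_eq_mul, mul_smul, smul_sub, Finset.smul_sum]

lemma quadric_mem_effCone : cls 2 ![1, 1, 1, 1, 1, 1, 1, 1] ∈ effCone :=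
  Submodule.subset_span (Or.inr (by simp [cls, Fin.sum_univ_eight]))

lemma plane_mem_effCone : cls 1 ![1, 1, 1, 0, 0, 0, 0, 0] ∈ effCone := by
  convert orbitE8_subset_effCone planeClass_zero_one_two_mem_orbitE8 using 1
  simp [cls, planeClass, Fin.sum_univ_eight]
  abel

lemma cubicCone_mem_effCone : cls 3 ![3, 1, 1, 1, 1, 1, 1, 1] ∈ effCone := by
  convert effCone.add_mem (orbitE8_subset_effCone quadricCone_mem_orbitE8)
    (orbitE8_subset_effCone planeClass_zero_six_seven_mem_orbitE8) using 1
  simp [cls, planeClass, Fin.sum_univ_eight]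
  module

lemma cls_combination_mem_effCone {a b c : ℝ} (ha : 0 ≤ a) (hb : 0 ≤ b) (hc : 0 ≤ c) :
    cls (2 * a + 3 * b + c)
      ![a + 3 * b + c, a + b + c, a + b + c, a + b, a + b, a + b, a + b, a + b] ∈ effCone := by
  have h := effCone.add_mem (effCone.add_mem
    (smul_mem_of_nonneg _ ha quadric_mem_effCone)
    (smul_mem_of_nonneg _ hb cubicCone_mem_effCone))
    (smul_mem_of_nonneg _ hc plane_mem_effCone)
  rw [← cls_smul, ← cls_smul, ← cls_smul, ← cls_add, ← cls_add] at h
  convert h using 2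
  · ring
  · ext i
    fin_cases i <;> simp <;> ring_nf

lemma cls_mem_effCone_of_standard {d : ℝ} {m : Fin 8 → ℝ} (hm : Antitone m)
    (hdeg : m 0 + m 1 + m 2 + m 3 ≤ 2 * d) (hd : m 0 ≤ d) (h7 : 0 ≤ m 7) :
    cls d m ∈ effCone := by
  have h01 : m 1 ≤ m 0 := hm (by decide)
  have h12 : m 2 ≤ m 1 := hm (by decide)
  have h23 : m 3 ≤ m 2 := hm (by decide)
  have h34 : m 4 ≤ m 3 := hm (by decide)
  have h45 : m 5 ≤ m 4 := hm (by decide)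
  have h56 : m 6 ≤ m 5 := hm (by decide)
  have h67 : m 7 ≤ m 6 := hm (by decide)
  rcases le_total (d - m 0) (m 3) with h | h
  · have key := cls_combination_mem_effCone (a := d - m 0) (b := m 3 - (d - m 0))
      (c := 2 * d - m 0 - 3 * m 3) (by linarith) (by linarith) (by linarith)
    rw [show 2 * (d - m 0) + 3 * (m 3 - (d - m 0)) + (2 * d - m 0 - 3 * m 3) = d by ring] at key
    refine cls_mem_effCone_of_le (fun i => ?_) key
    fin_cases i <;> simp <;> linarith
  · have key := cls_combination_mem_effCone (a := m 3) (b := 0) (c := d - 2 * m 3)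
      (by linarith) le_rfl (by linarith)
    rw [show 2 * m 3 + 3 * 0 + (d - 2 * m 3) = d by ring] at key
    refine cls_mem_effCone_of_le (fun i => ?_) key
    fin_cases i <;> simp <;> linarith

/-- **Theorem `thm:effcone` (key step):** every integer class `D = (d; m_1, …, m_8)`
in standard form with `d ≥ m_1` and `m_8 ≥ 0` lies in the convex cone generated by
the orbit `W·E_8` together with the class `−½K = 2H − ∑ E_i`. -/
theorem standard_form_in_effective_cone (d : ℤ) (m : Fin 8 → ℤ)
    (hsorted : ∀ i j : Fin 8, i ≤ j → m j ≤ m i)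
    (hdeg : m 0 + m 1 + m 2 + m 3 ≤ 2 * d)
    (hd : m 0 ≤ d) (hm8 : 0 ≤ m 7) :
    inCone (orbitE8 ∪ {(2 : ℝ) • Hv - ∑ i : Fin 8, Ev i})
      (cls (d : ℝ) fun i => (m i : ℝ)) := by
  have hm : Antitone fun i => (m i : ℝ) := fun i j hij =>
    Int.cast_le.2 (hsorted i j hij)
  exact inCone_of_mem_span (cls_mem_effCone_of_standard hm (by exact_mod_cast hdeg)
    (by exact_mod_cast hd) (by exact_mod_cast hm8))
end
end
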